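/- Under the Setup, every weak equivalence in M with the right lifting property with respect to J̃ has the right lifting property with respect to Ĩ. In particular, every J̃-injective weak equivalence has the right lifting property with respect to the map ∅ → 𝟙. -/

import Mathlib

open CategoryTheory CategoryTheory.Limits MonoidalCategory

universe v u v' u'

namespace Muro

variable {C : Type u} [Category.{v} C]

/-- `f` is a retract of `g` in the arrow category. -/
structure IsRetractOfArrow {X Y X' Y' : C} (f : X ⟶ Y) (g : X' ⟶ Y') : Prop where
  intro ::
  nonempty : ∃ (i : X ⟶ X') (r : X' ⟶ X) (i' : Y ⟶ Y') (r' : Y' ⟶ Y),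
    i ≫ r = 𝟙 X ∧ i' ≫ r' = 𝟙 Y ∧ i ≫ g = f ≫ i' ∧ r ≫ f = g ≫ r'

/-- A model structure on a category `C`: weak equivalences, cofibrations and
fibrations, subject to the usual axioms (2-out-of-3, closure under retracts,
lifting and factorization). -/
structure ModelStructure (C : Type u) [Category.{v} C] where
  W : MorphismProperty C
  Cof : MorphismProperty C
  Fib : MorphismProperty C
  W_id : ∀ X : C, W (𝟙 X)
  W_comp : ∀ ⦃X Y Z : C⦄ (f : X ⟶ Y) (g : Y ⟶ Z), W f → W g → W (f ≫ g)
  W_of_comp_left : ∀ ⦃X Y Z : C⦄ (f : X ⟶ Y) (g : Y ⟶ Z), W f → W (f ≫ g) → W g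
  W_of_comp_right : ∀ ⦃X Y Z : C⦄ (f : X ⟶ Y) (g : Y ⟶ Z), W g → W (f ≫ g) → W f
  W_retract : ∀ ⦃X Y X' Y' : C⦄ (f : X ⟶ Y) (g : X' ⟶ Y'),
    IsRetractOfArrow f g → W g → W f
  Cof_retract : ∀ ⦃X Y X' Y' : C⦄ (f : X ⟶ Y) (g : X' ⟶ Y'),
    IsRetractOfArrow f g → Cof g → Cof f
  Fib_retract : ∀ ⦃X Y X' Y' : C⦄ (f : X ⟶ Y) (g : X' ⟶ Y'),
    IsRetractOfArrow f g → Fib g → Fib f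
  lift_cof_trivFib : ∀ ⦃A B X Y : C⦄ (i : A ⟶ B) (p : X ⟶ Y),
    Cof i → Fib p → W p → HasLiftingProperty i p
  lift_trivCof_fib : ∀ ⦃A B X Y : C⦄ (i : A ⟶ B) (p : X ⟶ Y),
    Cof i → W i → Fib p → HasLiftingProperty i p
  factor_cof_trivFib : ∀ ⦃X Y : C⦄ (f : X ⟶ Y),
    ∃ (Z : C) (i : X ⟶ Z) (p : Z ⟶ Y), Cof i ∧ Fib p ∧ W p ∧ i ≫ p = f
  factor_trivCof_fib : ∀ ⦃X Y : C⦄ (f : X ⟶ Y),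
    ∃ (Z : C) (i : X ⟶ Z) (p : Z ⟶ Y), Cof i ∧ W i ∧ Fib p ∧ i ≫ p = f

/-- Trivial fibrations. -/
def ModelStructure.TrivFib (M : ModelStructure C) : MorphismProperty C :=
  fun _ _ f => M.Fib f ∧ M.W f

/-- Trivial cofibrations. -/
def ModelStructure.TrivCof (M : ModelStructure C) : MorphismProperty C :=
  fun _ _ f => M.Cof f ∧ M.W f

section Initial

variable [HasInitial C]

/-- An object is cofibrant if the map from the initial object is a cofibration. -/
def ModelStructure.Cofibrant (M : ModelStructure C) (X : C) : Prop :=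
  M.Cof (initial.to X)

end Initial

section Terminal

variable [HasTerminal C]

/-- An object is fibrant if the map to the terminal object is a fibration. -/
def ModelStructure.Fibrant (M : ModelStructure C) (X : C) : Prop :=
  M.Fib (terminal.from X)

end Terminal

section Monoidal

variable [MonoidalCategory C] [HasPushouts C]

/-- The push-out product `f ⊙ g : X⊗V ∪_{X⊗U} Y⊗U ⟶ Y⊗V` of `f : X ⟶ Y` and
`g : U ⟶ V`. -/
noncomputable def pushoutProduct {X Y U V : C} (f : X ⟶ Y) (g : U ⟶ V) :
    pushout (X ◁ g) (f ▷ U) ⟶ Y ⊗ V :=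
  pushout.desc (f ▷ V) (Y ◁ g) (whisker_exchange f g)

/-- The push-out product axiom of a monoidal model category. -/
def PushoutProductAxiom (M : ModelStructure C) : Prop :=
  (∀ ⦃X Y U V : C⦄ (f : X ⟶ Y) (g : U ⟶ V),
    M.Cof f → M.Cof g → M.Cof (pushoutProduct f g)) ∧
  (∀ ⦃X Y U V : C⦄ (f : X ⟶ Y) (g : U ⟶ V),
    M.Cof f → M.W f → M.Cof g → M.W (pushoutProduct f g)) ∧
  (∀ ⦃X Y U V : C⦄ (f : X ⟶ Y) (g : U ⟶ V),
    M.Cof f → M.Cof g → M.W g → M.W (pushoutProduct f g))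

variable [HasInitial C]

/-- `q : T ⟶ 𝟙` is a cofibrant resolution of the tensor unit: a weak
equivalence with cofibrant source. -/
def IsCofibrantResolutionOfUnit (M : ModelStructure C) {T : C} (q : T ⟶ 𝟙_ C) : Prop :=
  M.Cofibrant T ∧ M.W q

/-- The unit axiom of a monoidal model category: there is a cofibrant resolution
`q : 𝟙̃ ⟶ 𝟙` of the tensor unit such that `q ⊗ X` and `X ⊗ q` are weak
equivalences for every cofibrant `X`. -/
def UnitAxiom (M : ModelStructure C) : Prop :=
  ∃ (T : C) (q : T ⟶ 𝟙_ C), IsCofibrantResolutionOfUnit M q ∧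
    ∀ X : C, M.Cofibrant X → M.W (q ▷ X) ∧ M.W (X ◁ q)

/-- The very strong unit axiom for a cofibrant resolution `q : 𝟙̃ ⟶ 𝟙` of the
tensor unit: `q ⊗ X` and `X ⊗ q` are weak equivalences for *every* object `X`. -/
def VeryStrongUnitAxiom (M : ModelStructure C) {T : C} (q : T ⟶ 𝟙_ C) : Prop :=
  ∀ X : C, M.W (q ▷ X) ∧ M.W (X ◁ q)

/-- A monoidal model category: a model structure together with a monoidal
structure satisfying the push-out product axiom and the unit axiom. -/
structure MonoidalModel (C : Type u) [Category.{v} C] [MonoidalCategory C]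
    [HasInitial C] [HasPushouts C] extends ModelStructure C where
  ppAxiom : PushoutProductAxiom toModelStructure
  unitAxiom : UnitAxiom toModelStructure

/-- A map `f : X ⟶ Y` is surjective if the induced map
`M(𝟙, X) ⟶ M(𝟙, Y)` on hom-sets out of the tensor unit is surjective. -/
def SurjectiveOnUnit {X Y : C} (f : X ⟶ Y) : Prop :=
  Function.Surjective (fun g : 𝟙_ C ⟶ X => g ≫ f)

end Monoidal

end Muro

namespace Muro

/-- A well-ordered index for transfinite compositions: a well-ordered set with
a bottom element and successors. -/
class WellOrderData (J : Type v) extends LinearOrder J, OrderBot J, SuccOrder J where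
  wfLT : WellFoundedLT J

attribute [instance] WellOrderData.wfLT

variable {C : Type u} [Category.{v} C]

section Sequences

variable {J : Type v} [Preorder J]

/-- The inclusion functor `Set.Iio j ⥤ J`. -/
def iioFunctor (j : J) : Set.Iio j ⥤ J :=
  Monotone.functor (f := fun i : Set.Iio j => (i : J)) (fun _ _ h => h)

/-- Restriction of `F : J ⥤ C` to `Set.Iio j`. -/
def restrictionLT (F : J ⥤ C) (j : J) : Set.Iio j ⥤ C :=
  iioFunctor j ⋙ F

/-- The cocone on `restrictionLT F j` with apex `F.obj j`. -/
@[simps]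
def coconeLT (F : J ⥤ C) (j : J) : Cocone (restrictionLT F j) where
  pt := F.obj j
  ι :=
    { app := fun i => F.map (homOfLE i.2.le)
      naturality := fun i₁ i₂ φ => by
        dsimp [restrictionLT, iioFunctor, Monotone.functor]
        rw [Category.comp_id, ← F.map_comp]
        congr 1 }

end Sequences

section TransfiniteComposition

variable (K : MorphismProperty C)

/-- A witness that `f : X ⟶ Y` is a transfinite composition, indexed by the
well-ordered set `J`, of maps in `K`: a smooth (i.e. continuous at limit
elements) `J`-indexed sequence starting at `X`, whose successor maps lie in
`K` and whose colimit is `Y`, the composition of the sequence being `f`. -/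
structure TransfiniteCompositionOfShape (J : Type v) [WellOrderData J]
    {X Y : C} (f : X ⟶ Y) where
  F : J ⥤ C
  isoBot : F.obj ⊥ ≅ X
  step : ∀ j : J, ¬ IsMax j → K (F.map (homOfLE (Order.le_succ j)))
  smooth : ∀ j : J, Order.IsSuccLimit j → Nonempty (IsColimit (coconeLT F j))
  ι : F ⟶ (Functor.const J).obj Y
  isColimit : IsColimit (Cocone.mk Y ι)
  fac : f = isoBot.inv ≫ ι.app ⊥

/-- The class of transfinite compositions of maps in `K`. -/
def transfiniteCompositions : MorphismProperty C :=
  fun _ _ f => ∃ (J : Type v) (hJ : WellOrderData J),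
    letI := hJ
    Nonempty (TransfiniteCompositionOfShape K J f)

/-- The class of pushouts of maps in `K`. -/
def pushoutsOf : MorphismProperty C :=
  fun X Y f => ∃ (A B : C) (g : A ⟶ B) (u : A ⟶ X) (v : B ⟶ Y),
    K g ∧ IsPushout u g f v

/-- Relative `K`-cell complexes: transfinite compositions of pushouts of maps
in `K`. -/
def relativeCellComplexes : MorphismProperty C :=
  transfiniteCompositions (pushoutsOf K)

/-- `K`-injective maps: maps with the right lifting property with respect to
all maps in `K`. -/
def rlp : MorphismProperty C :=
  fun _ _ p => ∀ ⦃A B : C⦄ (i : A ⟶ B), K i → HasLiftingProperty i p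

/-- Maps with the left lifting property with respect to all maps in `K`.
`K`-cofibrations are the maps in `llp (rlp K)`. -/
def llp : MorphismProperty C :=
  fun _ _ i => ∀ ⦃A B : C⦄ (p : A ⟶ B), K p → HasLiftingProperty i p

/-- A smooth `J`-indexed sequence with successor maps in `K`. -/
structure SmoothSequence (J : Type v) [WellOrderData J] where
  F : J ⥤ C
  step : ∀ j : J, ¬ IsMax j → K (F.map (homOfLE (Order.le_succ j)))
  smooth : ∀ j : J, Order.IsSuccLimit j → Nonempty (IsColimit (coconeLT F j))

/-- The object `A` is small relative to the class of maps `K` (Hovey,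
Definition 2.1.3): there is a regular cardinal `κ` such that for every
`κ`-filtered well-ordered set `J` (i.e. one of cofinality `> κ`) and every
smooth `J`-indexed sequence with successor maps in `K` and colimit `c`, the
canonical map `colim_j C(A, F j) ⟶ C(A, c.pt)` is bijective (expressed
concretely as: every map `A ⟶ c.pt` factors through some stage, and two
factorizations through a stage are identified at some later stage). -/
def IsSmallRel (A : C) : Prop :=
  ∃ κ : Cardinal.{v}, κ.IsRegular ∧
    ∀ (J : Type v) (hJ : WellOrderData J),
      letI := hJ
      κ < (Ordinal.type ((· < ·) : J → J → Prop)).cof →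
      ∀ (S : SmoothSequence K J) (c : Cocone S.F), IsColimit c →
        (∀ g : A ⟶ c.pt, ∃ (j : J) (h : A ⟶ S.F.obj j), g = h ≫ c.ι.app j) ∧
        (∀ (j : J) (h h' : A ⟶ S.F.obj j), h ≫ c.ι.app j = h' ≫ c.ι.app j →
          ∃ (k : J) (hk : j ≤ k),
            h ≫ S.F.map (homOfLE hk) = h' ≫ S.F.map (homOfLE hk))

/-- The class `K` is indexed by a set (i.e. a small family of maps). -/
def IsSetIndexed : Prop :=
  ∃ (ι : Type v) (A B : ι → C) (g : ∀ i, A i ⟶ B i),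
    ∀ ⦃X Y : C⦄ (f : X ⟶ Y), K f ↔ ∃ i, Arrow.mk f = Arrow.mk (g i)

end TransfiniteComposition

/-- `M` is cofibrantly generated by the set `I` of generating cofibrations and
the set `Jg` of generating trivial cofibrations. -/
structure CofibrantlyGeneratedBy (M : ModelStructure C)
    (I Jg : MorphismProperty C) : Prop where
  setI : IsSetIndexed I
  setJ : IsSetIndexed Jg
  smallI : ∀ ⦃A B : C⦄ (i : A ⟶ B), I i → IsSmallRel (relativeCellComplexes I) A
  smallJ : ∀ ⦃A B : C⦄ (i : A ⟶ B), Jg i → IsSmallRel (relativeCellComplexes Jg) A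
  fib_eq : M.Fib = rlp Jg
  trivFib_eq : M.TrivFib = rlp I

end Muro

namespace Muro

variable {C : Type u} [Category.{v} C] [MonoidalCategory C] [HasInitial C]
  [HasPushouts C] [HasBinaryCoproducts C]

/-- `Ĩ = I ∪ {∅ ⟶ 𝟙}`. -/
def tildeI (I : MorphismProperty C) : MorphismProperty C :=
  fun _ _ f => I f ∨ Arrow.mk f = Arrow.mk (initial.to (𝟙_ C))

/-- `J̃ = J ∪ {j ∘ i₁ : 𝟙̃ ⟶ C}` for a given map `ji₁ : 𝟙̃ ⟶ C`. -/
def tildeJ (Jg : MorphismProperty C) {T Cob : C} (ji₁ : T ⟶ Cob) :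
    MorphismProperty C :=
  fun _ _ f => Jg f ∨ Arrow.mk f = Arrow.mk ji₁

/-- The Setup of the paper: `M` is a cofibrantly generated monoidal model
category satisfying the very strong unit axiom for a cofibrant resolution
`q : 𝟙̃ ⟶ 𝟙`, with generating cofibrations `I` and generating trivial
cofibrations `Jg`; a factorization `𝟙̃ ⊔ 𝟙 —j→ C —p→ 𝟙` of `(q, id)` into a
cofibration followed by a weak equivalence is fixed; the domains of `I` are
small relative to relative `Ĩ`-cell complexes, and the domains of `Jg` are
small relative to relative `J̃`-cell complexes, where `Ĩ = I ∪ {∅ ⟶ 𝟙}` and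
`J̃ = Jg ∪ {j ∘ i₁}`. -/
structure Setup (C : Type u) [Category.{v} C] [MonoidalCategory C]
    [HasInitial C] [HasPushouts C] [HasBinaryCoproducts C] where
  M : ModelStructure C
  ppAxiom : PushoutProductAxiom M
  unitAxiom : UnitAxiom M
  I : MorphismProperty C
  Jg : MorphismProperty C
  cofGen : CofibrantlyGeneratedBy M I Jg
  T : C
  q : T ⟶ 𝟙_ C
  resolution : IsCofibrantResolutionOfUnit M q
  vsua : VeryStrongUnitAxiom M q
  Cob : C
  j : T ⨿ 𝟙_ C ⟶ Cob
  p : Cob ⟶ 𝟙_ C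
  cof_j : M.Cof j
  weq_p : M.W p
  factorization : j ≫ p = coprod.desc q (𝟙 (𝟙_ C))
  smallI : ∀ ⦃A B : C⦄ (i : A ⟶ B), I i →
    IsSmallRel (relativeCellComplexes (tildeI I)) A
  smallJ : ∀ ⦃A B : C⦄ (i : A ⟶ B), Jg i →
    IsSmallRel (relativeCellComplexes
      (tildeJ Jg ((coprod.inl : T ⟶ T ⨿ 𝟙_ C) ≫ j))) A

/-- The map `j ∘ i₁ : 𝟙̃ ⟶ C` of the Setup. -/
noncomputable def Setup.ji₁ (S : Setup C) : S.T ⟶ S.Cob :=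
  (coprod.inl : S.T ⟶ S.T ⨿ 𝟙_ C) ≫ S.j

/-- The set `Ĩ` of the Setup. -/
def Setup.tI (S : Setup C) : MorphismProperty C := tildeI S.I

/-- The set `J̃` of the Setup. -/
noncomputable def Setup.tJ (S : Setup C) : MorphismProperty C := tildeJ S.Jg S.ji₁

/-- `Mt` is the model structure `M̃` of the paper associated with the Setup
`S`: it has the same weak equivalences as `M`, it is generated by `Ĩ` and `J̃`,
i.e. its trivial fibrations are the `Ĩ`-injective maps, its fibrations are the
`J̃`-injective maps, and its cofibrations are the `Ĩ`-cofibrations. -/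
structure Setup.IsTildeModel (S : Setup C) (Mt : ModelStructure C) : Prop where
  weq_eq : Mt.W = S.M.W
  trivFib_eq : Mt.TrivFib = rlp S.tI
  fib_eq : Mt.Fib = rlp S.tJ
  cof_eq : Mt.Cof = llp (rlp S.tI)

end Muro

namespace Muro

variable {C : Type u} [Category.{v} C]

/-- Right properness: weak equivalences are preserved by pullback along
fibrations. -/
def RightProper (M : ModelStructure C) : Prop :=
  ∀ ⦃P X Z Y : C⦄ (fst : P ⟶ X) (snd : P ⟶ Z) (f : X ⟶ Y) (g : Z ⟶ Y),
    M.W f → M.Fib g → IsPullback fst snd f g → M.W snd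

/-- Left properness: weak equivalences are preserved by pushout along
cofibrations. -/
def LeftProper (M : ModelStructure C) : Prop :=
  ∀ ⦃X Y Z P : C⦄ (f : X ⟶ Y) (g : X ⟶ Z) (inl : Y ⟶ P) (inr : Z ⟶ P),
    M.W f → M.Cof g → IsPushout f g inl inr → M.W inr

section Monoidal

variable [MonoidalCategory C]

/-- The class of maps of the form `t ⊗ Z` with `t` a trivial cofibration and
`Z` any object. -/
def tensorTrivCofMaps (M : ModelStructure C) : MorphismProperty C :=
  fun _ _ g => ∃ (A B Z : C) (t : A ⟶ B), M.Cof t ∧ M.W t ∧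
    Arrow.mk g = Arrow.mk (t ▷ Z)

/-- The monoid axiom: every transfinite composition of pushouts of maps of the
form `t ⊗ Z`, with `t` a trivial cofibration and `Z` any object, is a weak
equivalence. -/
def MonoidAxiom (M : ModelStructure C) : Prop :=
  ∀ ⦃X Y : C⦄ (f : X ⟶ Y),
    transfiniteCompositions (pushoutsOf (tensorTrivCofMaps M)) f → M.W f

/-- An object `A` is cofibrant mod `𝟙` if it is a retract of an object `X`
admitting a cofibration `𝟙^(S) ⟶ X` from a coproduct of copies of the tensor
unit indexed by some (possibly empty) set `S`. -/
def CofibrantModOne [HasCoproducts.{v} C] (M : ModelStructure C) (A : C) : Prop :=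
  ∃ (X : C) (i : A ⟶ X) (r : X ⟶ A), i ≫ r = 𝟙 A ∧
    ∃ (S : Type v) (c : (∐ fun _ : S => 𝟙_ C) ⟶ X), M.Cof c

/-- Pseudo-cofibrations: maps `f` such that `f ⊙ g` and `g ⊙ f` are
cofibrations for every cofibration `g`, and trivial cofibrations for every
trivial cofibration `g`. -/
def PseudoCofibrations [HasPushouts C] (M : ModelStructure C) :
    MorphismProperty C :=
  fun _ _ f =>
    (∀ ⦃U V : C⦄ (g : U ⟶ V), M.Cof g →
      M.Cof (pushoutProduct f g) ∧ M.Cof (pushoutProduct g f)) ∧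
    (∀ ⦃U V : C⦄ (g : U ⟶ V), M.Cof g → M.W g →
      (M.Cof (pushoutProduct f g) ∧ M.W (pushoutProduct f g)) ∧
      (M.Cof (pushoutProduct g f) ∧ M.W (pushoutProduct g f)))

end Monoidal

end Muro

namespace Muro

theorem rlp_tildeI_iff {C : Type u} [Category.{v} C] [MonoidalCategory C] [HasInitial C]
    {I : MorphismProperty C} {X Y : C} {f : X ⟶ Y} :
    rlp (tildeI I) f ↔ rlp I f ∧ HasLiftingProperty (initial.to (𝟙_ C)) f := by
  refine ⟨fun h => ⟨fun _ _ i hi => h i (Or.inl hi), h _ (Or.inr rfl)⟩, ?_⟩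
  rintro ⟨hI, hf⟩ A B i (hi | hi)
  · exact hI i hi
  · exact (HasLiftingProperty.iff_of_arrow_iso_left (eqToIso hi) f).2 hf

/-- A `J̃`-injective trivial fibration lifts maps out of the tensor unit: first lift along
`∅ ⟶ 𝟙̃`, then along `𝟙̃ ⟶ C`, and restrict the result along `𝟙 ⟶ C`. -/
theorem Setup.hasLiftingProperty_initial_to_unit {C : Type u} [Category.{v} C]
    [MonoidalCategory C] [HasInitial C] [HasPushouts C] [HasBinaryCoproducts C] (S : Setup C)
    {X Y : C} {f : X ⟶ Y} (hW : S.M.W f) (hFib : S.M.Fib f)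
    [HasLiftingProperty S.ji₁ f] :
    HasLiftingProperty (initial.to (𝟙_ C)) f where
  sq_hasLift {t y} sq := by
    have := S.M.lift_cof_trivFib _ f S.resolution.1 hFib hW
    have sqT : CommSq t (initial.to S.T) f (S.q ≫ y) := ⟨initialIsInitial.hom_ext _ _⟩
    have sqC : CommSq sqT.lift S.ji₁ f (S.p ≫ y) := ⟨by
      simp [Setup.ji₁, reassoc_of% S.factorization, coprod.inl_desc]⟩
    exact ⟨⟨{ l := coprod.inr ≫ S.j ≫ sqC.lift
              fac_left := initialIsInitial.hom_ext _ _
              fac_right := by simp [reassoc_of% S.factorization, coprod.inr_desc] }⟩⟩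

/-- Under the Setup, every weak equivalence in `M` which is
`J̃`-injective is `Ĩ`-injective; in particular, every `J̃`-injective weak
equivalence has the right lifting property with respect to `∅ ⟶ 𝟙`. -/
theorem tildeJ_injective_weq_tildeI_injective {C : Type u} [Category.{v} C]
    [MonoidalCategory C] [HasInitial C] [HasPushouts C]
    [HasBinaryCoproducts C] (S : Setup C) :
    ∀ ⦃X Y : C⦄ (f : X ⟶ Y), S.M.W f → rlp S.tJ f →
      rlp S.tI f ∧ HasLiftingProperty (initial.to (𝟙_ C)) f := by
  intro X Y f hW hJ
  have hFib : S.M.Fib f := by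
    rw [S.cofGen.fib_eq]
    exact fun _ _ i hi => hJ i (Or.inl hi)
  have hI : rlp S.I f := by
    rw [← S.cofGen.trivFib_eq]
    exact ⟨hFib, hW⟩
  have : HasLiftingProperty S.ji₁ f := hJ _ (Or.inr rfl)
  have hUnit := S.hasLiftingProperty_initial_to_unit hW hFib
  exact ⟨rlp_tildeI_iff.2 ⟨hI, hUnit⟩, hUnit⟩

end Muro
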